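/- arXiv:1710.02548 — 3 statements merged into one kernel-verified Lean document; each statement's English description precedes it below -/
import Mathlib

section
/- Under the SFA stationary measure π̃, the marginal distribution of the total number of customers at any single resource is geometric with parameter g_l: for every resource l ∈ L and every k ∈ ℕ, Σ_{m : K → ℕ, m_l = k} π̃(m) = (1 − g_l) g_l^k, where m_l = Σ_{j : (l,j) ∈ K} m(l,j). -/
open scoped BigOperators

noncomputable section

/-- The set of resource-route pairs `(l,j)` actually used, i.e. with `B l j > 0`. -/
abbrev sfaK {L J : Type*} (B : L → J → ℝ) := {p : L × J // 0 < B p.1 p.2}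

/-- The weight function of the SFA stationary measure:
`w(m) = ∏_l [ m_l! / ∏_j m_{lj}! ] · ∏_{(l,j) ∈ K} (B_{lj} α_j / C_l)^{m_{lj}}`. -/
noncomputable def sfaW {L J : Type*} [Fintype L] [Fintype J]
    (B : L → J → ℝ) (C : L → ℝ) (α : J → ℝ) (m : sfaK B → ℕ) : ℝ :=
  (∏ l : L,
      ((Nat.factorial (∑ j : {j : J // 0 < B l j}, m ⟨(l, j.1), j.2⟩) : ℝ) /
        ∏ j : {j : J // 0 < B l j}, (Nat.factorial (m ⟨(l, j.1), j.2⟩) : ℝ))) *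
    ∏ p : sfaK B, (B p.1.1 p.1.2 * α p.1.2 / C p.1.1) ^ m p

/-- The normalizing constant `Φ = ∏_l C_l / (C_l - Σ_j B_{lj} α_j)`. -/
noncomputable def sfaPhi {L J : Type*} [Fintype L] [Fintype J]
    (B : L → J → ℝ) (C : L → ℝ) (α : J → ℝ) : ℝ :=
  ∏ l : L, C l / (C l - ∑ j : J, B l j * α j)

/-- Weight of a single resource. -/
def sfaF {ι : Type*} [Fintype ι] (x : ι → ℝ) (n : ι → ℕ) : ℝ :=
  ((Nat.factorial (∑ j, n j) : ℝ) / ∏ j, (Nat.factorial (n j) : ℝ)) * ∏ j, x j ^ n j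

lemma sfaF_nonneg {ι : Type*} [Fintype ι] (x : ι → ℝ) (hx : ∀ i, 0 ≤ x i) (n : ι → ℕ) :
    0 ≤ sfaF x n := by
  unfold sfaF
  have := Finset.prod_nonneg (s := Finset.univ) (fun j _ => pow_nonneg (hx j) (n j))
  positivity

lemma sfaF_hasSum_level {ι : Type*} [Fintype ι] (x : ι → ℝ) (k : ℕ) :
    HasSum (fun n : ι → ℕ => if ∑ j, n j = k then sfaF x n else 0) ((∑ j, x j) ^ k) := by
  classical
  rw [Finset.sum_pow_eq_sum_piAntidiag]
  have h : ∑ n ∈ Finset.piAntidiag Finset.univ k,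
      (Nat.multinomial Finset.univ n : ℝ) * ∏ i, x i ^ n i =
      ∑ n ∈ Finset.piAntidiag Finset.univ k, (if ∑ j, n j = k then sfaF x n else 0) := by
    refine Finset.sum_congr rfl fun n hn => ?_
    rw [Finset.mem_piAntidiag] at hn
    rw [if_pos hn.1, sfaF]
    congr 1
    rw [eq_div_iff (by positivity), mul_comm]
    exact_mod_cast Nat.multinomial_spec Finset.univ n
  rw [h]
  refine hasSum_sum_of_ne_finset_zero fun n hn => ?_
  rw [if_neg]
  intro hk
  exact hn (by simp [hk])

lemma sfaF_hasSum {ι : Type*} [Fintype ι] (x : ι → ℝ) (hx : ∀ i, 0 ≤ x i)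
    (h1 : ∑ j, x j < 1) : HasSum (sfaF x) (1 - ∑ j, x j)⁻¹ := by
  have hgeo := hasSum_geometric_of_lt_one (Finset.sum_nonneg fun j _ => hx j) h1
  let G : ℕ × (ι → ℕ) → ℝ := fun p => if ∑ j, p.2 j = p.1 then sfaF x p.2 else 0
  have hG0 : 0 ≤ G := fun p => by
    show 0 ≤ if ∑ j, p.2 j = p.1 then sfaF x p.2 else 0
    split_ifs
    · exact sfaF_nonneg x hx _
    · exact le_rfl
  have hGs : Summable G := by
    rw [summable_prod_of_nonneg hG0]
    refine ⟨fun k => (sfaF_hasSum_level x k).summable, ?_⟩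
    have : (fun k => ∑' n, G (k, n)) = fun k => (∑ j, x j) ^ k :=
      funext fun k => (sfaF_hasSum_level x k).tsum_eq
    rw [this]
    exact hgeo.summable
  have e := (hGs.hasSum.prod_fiberwise (fun k => sfaF_hasSum_level x k)).unique hgeo
  have hG := hGs.hasSum
  rw [e] at hG
  have hG' := (Equiv.prodComm (ι → ℕ) ℕ).hasSum_iff.mpr hG
  refine hG'.prod_fiberwise fun n => ?_
  have := hasSum_ite_eq (∑ j, n j) (sfaF x n)
  convert this using 2 with k
  simp [G, eq_comm]

/-- The product property for finite families of sums. -/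
def PiProdProp.{u, v} (ι : Type u) [Fintype ι] : Prop :=
  ∀ (β : ι → Type v) (f : ∀ i, β i → ℝ) (a : ι → ℝ),
    (∀ i b, 0 ≤ f i b) → (∀ i, HasSum (f i) (a i)) →
    HasSum (fun b : ∀ i, β i => ∏ i, f i (b i)) (∏ i, a i)

lemma piProdProp_equiv.{u, v} (ι κ : Type u) [Fintype ι] [Fintype κ] (e : ι ≃ κ)
    (ih : PiProdProp.{u, v} ι) : PiProdProp.{u, v} κ := by
  intro β f a h0 h
  have := ih (fun i => β (e i)) (fun i => f (e i)) (fun i => a (e i)) (fun i => h0 _)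
    (fun i => h _)
  rw [e.prod_comp a] at this
  rw [← (Equiv.piCongrLeft β e).hasSum_iff]
  have h5 : (fun b : ∀ i, β i => ∏ i, f i (b i)) ∘ (Equiv.piCongrLeft β e) =
      fun b => ∏ i, f (e i) (b i) := by
    funext b
    simp only [Function.comp]
    rw [← e.prod_comp]
    refine Finset.prod_congr rfl fun i _ => ?_
    rw [Equiv.piCongrLeft_apply_apply]
  rw [h5]
  exact this

lemma piProdProp_empty.{u, v} : PiProdProp.{u, v} PEmpty.{u + 1} := by
  intro β f a h0 h
  simpa using hasSum_unique (fun b : ∀ i : PEmpty, β i => (1:ℝ))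

lemma piProdProp_option.{u, v} (ι : Type u) [Fintype ι]
    (ih : PiProdProp.{u, v} ι) : PiProdProp.{u, v} (Option ι) := by
  intro β f a h0 h
  have h2 := ih (fun i => β (some i)) (fun i => f (some i)) (fun i => a (some i))
    (fun i => h0 _) (fun i => h _)
  have h3 := (h none).mul h2 ((h none).summable.mul_of_nonneg h2.summable (fun b => h0 _ b)
    (fun b => Finset.prod_nonneg fun i _ => h0 _ _))
  rw [Fintype.prod_option]
  have h4 := (Equiv.piOptionEquivProd (β := β)).hasSum_iff.mpr h3
  have h5 : (fun b : ∀ i, β i => ∏ i, f i (b i)) =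
      fun b => f none (b none) * ∏ i, f (some i) (b (some i)) :=
    funext fun b => Fintype.prod_option _
  rw [h5]
  exact h4

lemma piProdProp_all.{u, v} (ι : Type u) [Fintype ι] : PiProdProp.{u, v} ι :=
  Fintype.induction_empty_option (P := fun ι _ => PiProdProp.{u, v} ι)
    (fun ι κ _ e ih => @piProdProp_equiv ι κ (Fintype.ofEquiv κ e.symm) _ e ih)
    piProdProp_empty (fun ι _ ih => piProdProp_option ι ih) ι

/-- Pairs as a sigma type. -/
def sfaSigma {L J : Type*} (B : L → J → ℝ) : (Σ l : L, {j : J // 0 < B l j}) ≃ sfaK B where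
  toFun p := ⟨(p.1, p.2.1), p.2.2⟩
  invFun p := ⟨p.1.1, ⟨p.1.2, p.2⟩⟩
  left_inv _ := rfl
  right_inv _ := rfl

/-- States split by resource. -/
def sfaCurry {L J : Type*} (B : L → J → ℝ) :
    (sfaK B → ℕ) ≃ (∀ l : L, {j : J // 0 < B l j} → ℕ) where
  toFun m l j := m ⟨(l, j.1), j.2⟩
  invFun n p := n p.1.1 ⟨p.1.2, p.2⟩
  left_inv _ := rfl
  right_inv _ := rfl

lemma sfaW_eq {L J : Type*} [Fintype L] [Fintype J]
    (B : L → J → ℝ) (C : L → ℝ) (α : J → ℝ) (m : sfaK B → ℕ) :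
    sfaW B C α m = ∏ l, sfaF (fun j : {j : J // 0 < B l j} => B l j.1 * α j.1 / C l)
      (sfaCurry B m l) := by
  unfold sfaW sfaF
  rw [Finset.prod_mul_distrib]
  congr 1
  rw [← (sfaSigma B).prod_comp, Fintype.prod_sigma]
  rfl

/-- under the SFA stationary measure `π̃(m) = w(m)/Φ`, the marginal
distribution of the total number of customers `m_l` at any single resource `l` is
geometric with parameter `g_l`:  `Σ_{m : m_l = k} π̃(m) = (1 - g_l) g_l^k`. -/
theorem sfa_resource_total_geometric
    {L J : Type*} [Fintype L] [Fintype J] [Nonempty L] [Nonempty J]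
    (B : L → J → ℝ) (C : L → ℝ) (α : J → ℝ)
    (hB : ∀ l j, 0 ≤ B l j) (hC : ∀ l, 0 < C l) (hα : ∀ j, 0 ≤ α j)
    (hg : ∀ l, (∑ j : J, B l j * α j) / C l < 1)
    (l : L) (k : ℕ) :
    (∑' m : {m : sfaK B → ℕ //
        (∑ j : {j : J // 0 < B l j}, m ⟨(l, j.1), j.2⟩) = k},
        sfaW B C α m.1 / sfaPhi B C α) =
      (1 - (∑ j : J, B l j * α j) / C l) * ((∑ j : J, B l j * α j) / C l) ^ k := by
  classical
  set g : L → ℝ := fun l => (∑ j : J, B l j * α j) / C l with hgdef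
  let x : ∀ l : L, {j : J // 0 < B l j} → ℝ := fun l j => B l j.1 * α j.1 / C l
  have hx : ∀ l j, 0 ≤ x l j := fun l j =>
    div_nonneg (mul_nonneg (hB _ _) (hα _)) (hC l).le
  have hxs : ∀ l, ∑ j, x l j = g l := by
    intro l
    simp only [x, hgdef]
    rw [← Finset.sum_div]
    congr 1
    have h1 := Fintype.sum_subtype_add_sum_subtype (fun j => 0 < B l j) (fun j => B l j * α j)
    have h2 : ∑ j : {j : J // ¬ 0 < B l j}, B l j.1 * α j.1 = 0 :=
      Finset.sum_eq_zero fun j _ => by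
        rw [le_antisymm (not_lt.mp j.2) (hB _ _), zero_mul]
    rw [h2, add_zero] at h1
    convert h1
  have hlt : ∀ l, g l < 1 := hg
  let f : ∀ i : L, ({j : J // 0 < B i j} → ℕ) → ℝ := fun i n =>
    if i = l then (if ∑ j, n j = k then sfaF (x i) n else 0) else sfaF (x i) n
  let a : L → ℝ := fun i => if i = l then g i ^ k else (1 - g i)⁻¹
  have hf0 : ∀ i n, 0 ≤ f i n := by
    intro i n
    have := sfaF_nonneg (x i) (hx i) n
    simp only [f]
    split_ifs <;> simp [this]
  have hfs : ∀ i, HasSum (f i) (a i) := by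
    intro i
    by_cases hi : i = l
    · simp only [f, a, if_pos hi]
      have := sfaF_hasSum_level (x i) k
      rwa [hxs] at this
    · simp only [f, a, hi, if_false]
      have := sfaF_hasSum (x i) (hx i) (by rw [hxs]; exact hlt i)
      rwa [hxs] at this
  have hp := (sfaCurry B).hasSum_iff.mpr (piProdProp_all L _ f a hf0 hfs)
  have hind : (fun b : ∀ i, {j : J // 0 < B i j} → ℕ => ∏ i, f i (b i)) ∘ (sfaCurry B) =
      Set.indicator {m : sfaK B → ℕ | (∑ j : {j : J // 0 < B l j}, m ⟨(l, j.1), j.2⟩) = k}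
        (sfaW B C α) := by
    funext m
    simp only [Function.comp]
    by_cases hm : (∑ j : {j : J // 0 < B l j}, m ⟨(l, j.1), j.2⟩) = k
    · rw [Set.indicator_of_mem (by exact hm), sfaW_eq]
      refine Finset.prod_congr rfl fun i _ => ?_
      by_cases hi : i = l
      · subst hi
        simp only [f, if_true]
        exact if_pos hm
      · simp only [f, hi, if_false, x]
    · rw [Set.indicator_of_notMem (by exact hm)]
      refine Finset.prod_eq_zero (Finset.mem_univ l) ?_
      simp only [f, if_true]
      exact if_neg hm
  rw [hind, ← hasSum_subtype_iff_indicator] at hp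
  have hPhi : sfaPhi B C α = ∏ i, (1 - g i)⁻¹ := by
    unfold sfaPhi
    refine Finset.prod_congr rfl fun i _ => ?_
    have := (hC i).ne'
    simp only [hgdef]
    rw [one_sub_div this, inv_div]
  refine (hp.div_const (sfaPhi B C α)).tsum_eq.trans ?_
  have hne : ∀ i, 1 - g i ≠ 0 := fun i => (sub_pos.mpr (hlt i)).ne'
  rw [hPhi, ← Finset.prod_div_distrib, Finset.prod_eq_single l]
  · simp only [a, if_true]
    rw [div_inv_eq_mul, mul_comm]
  · intro i _ hi
    simp only [a, hi, if_false]
    exact div_self (inv_ne_zero (hne i))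
  · intro h
    exact absurd (Finset.mem_univ l) h
end
end

section
/- Expected number of flows on a route under the SFA stationary distribution (Proposition 4.3): under the stability condition g_l < 1 for all l ∈ L, for every route j ∈ J the family n ↦ n_j · π(n) over n : J → ℕ is summable and Σ_{n : J → ℕ} n_j · π(n) = Σ_{l : (l,j) ∈ K} (B_{lj} α_j / C_l) · 1/(1 − g_l), where π(n) = Φ(n) ∏_{i ∈ J} α_i^{n_i} / Φ. -/
open scoped BigOperators

noncomputable section

/-- The set `U(n)` of multi-configurations `m : K → ℕ` compatible with the route-level
counts `n : J → ℕ`, i.e. `Σ_{l : (l,j) ∈ K} m(l,j) = n_j` for all `j`. -/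
abbrev sfaU {L J : Type*} [Fintype L] (B : L → J → ℝ) (n : J → ℕ) :=
  {m : sfaK B → ℕ // ∀ j : J, (∑ l : {l : L // 0 < B l j}, m ⟨(l.1, j), l.2⟩) = n j}

/-- `Φ(n) = Σ_{m ∈ U(n)} ∏_l [ m_l!/∏_j m_{lj}! ] · ∏_{(l,j) ∈ K} (B_{lj}/C_l)^{m_{lj}}`
(the set `U(n)` is finite, so the `tsum` is just the finite sum). -/
noncomputable def sfaPhiFun {L J : Type*} [Fintype L] [Fintype J]
    (B : L → J → ℝ) (C : L → ℝ) (n : J → ℕ) : ℝ :=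
  ∑' m : sfaU B n,
    (∏ l : L,
        ((Nat.factorial (∑ j : {j : J // 0 < B l j}, m.1 ⟨(l, j.1), j.2⟩) : ℝ) /
          ∏ j : {j : J // 0 < B l j}, (Nat.factorial (m.1 ⟨(l, j.1), j.2⟩) : ℝ))) *
      ∏ p : sfaK B, (B p.1.1 p.1.2 / C p.1.1) ^ m.1 p

theorem sfa_aux_tsum_pi {ι : Type*} [Fintype ι] {β : ι → Type*}
    (f : ∀ i, β i → ENNReal) :
    ∑' m : (∀ i, β i), ∏ i, f i (m i) = ∏ i, ∑' b, f i b := by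
  classical
  suffices H : ∀ (n : ℕ) (β : Fin n → Type _) (f : ∀ i, β i → ENNReal),
      ∑' m : (∀ i, β i), ∏ i, f i (m i) = ∏ i, ∑' b, f i b by
    let e := (Fintype.equivFin ι).symm
    have h := H _ (fun i => β (e i)) (fun i => f (e i))
    rw [← (Equiv.piCongrLeft β e).tsum_eq]
    rw [← e.prod_comp (fun i => ∑' b, f i b), ← h]
    refine tsum_congr fun m => ?_
    rw [← e.prod_comp]
    refine Finset.prod_congr rfl fun i _ => ?_
    rw [Equiv.piCongrLeft_apply_apply]
  intro n
  induction n with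
  | zero => intro β f; simp [tsum_fintype]
  | succ n ih =>
    intro β f
    rw [← (Fin.consEquiv β).tsum_eq, ENNReal.tsum_prod', Fin.prod_univ_succ,
      ← ih (fun i => β i.succ) (fun i => f i.succ), ← ENNReal.tsum_mul_right]
    refine tsum_congr fun a => ?_
    rw [← ENNReal.tsum_mul_left]
    refine tsum_congr fun m => ?_
    simp [Fin.prod_univ_succ, Fin.consEquiv]

theorem sfa_aux_multi {ι : Type*} [Fintype ι] (x : ι → ENNReal) (c : ℕ → ENNReal) :
    ∑' m : ι → ℕ, c (∑ i, m i) * (Nat.multinomial Finset.univ m * ∏ i, x i ^ m i) =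
      ∑' N, c N * (∑ i, x i) ^ N := by
  classical
  rw [← ENNReal.tsum_fiberwise _ (fun m : ι → ℕ => ∑ i, m i)]
  refine tsum_congr fun N => ?_
  rw [Finset.sum_pow_eq_sum_piAntidiag, Finset.mul_sum]
  have hs : ((fun m : ι → ℕ => ∑ i, m i) ⁻¹' {N}) =
      ((Finset.piAntidiag Finset.univ N : Finset (ι → ℕ)) : Set (ι → ℕ)) := by
    ext m; simp
  rw [hs, Finset.tsum_subtype' (Finset.piAntidiag Finset.univ N)
    (fun m : ι → ℕ => c (∑ i, m i) * (Nat.multinomial Finset.univ m * ∏ i, x i ^ m i))]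
  refine Finset.sum_congr rfl fun m hm => ?_
  rw [Finset.mem_piAntidiag] at hm
  rw [hm.1]

theorem sfa_aux_shift {ι : Type*} [Fintype ι] [DecidableEq ι] (m : ι → ℕ) (j : ι) :
    (m j + 1) * Nat.multinomial Finset.univ (m + Pi.single j 1) =
      (∑ i, m i + 1) * Nat.multinomial Finset.univ m := by
  have h1 := Nat.multinomial_spec Finset.univ m
  have h2 := Nat.multinomial_spec Finset.univ (m + Pi.single j 1)
  have h3 : ∑ i, (m + Pi.single j 1 : ι → ℕ) i = ∑ i, m i + 1 := by
    simp [Finset.sum_add_distrib]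
  have h4 : ∏ i, ((m + Pi.single j 1 : ι → ℕ) i).factorial = (m j + 1) * ∏ i, (m i).factorial := by
    rw [Fintype.prod_eq_mul_prod_compl j, Fintype.prod_eq_mul_prod_compl j (fun i => (m i).factorial),
      ← mul_assoc]
    congr 1
    · simp [Nat.factorial_succ]
    · refine Finset.prod_congr rfl fun i hi => ?_
      simp at hi
      simp [hi]
  rw [h3, h4, Nat.factorial_succ, ← h1] at h2
  have hp : 0 < ∏ i, (m i).factorial := Finset.prod_pos fun i _ => Nat.factorial_pos _
  apply Nat.eq_of_mul_eq_mul_left hp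
  linarith

theorem sfa_aux_moment {ι : Type*} [Fintype ι] (x : ι → ENNReal) (j : ι) :
    ∑' m : ι → ℕ, (m j : ENNReal) * (Nat.multinomial Finset.univ m * ∏ i, x i ^ m i) =
      x j * ∑' N : ℕ, ((N : ENNReal) + 1) * (∑ i, x i) ^ N := by
  classical
  rw [← sfa_aux_multi x (fun N => (N : ENNReal) + 1), ← ENNReal.tsum_mul_left]
  have hinj : Function.Injective (fun m : ι → ℕ => m + Pi.single j 1) :=
    fun a b h => add_right_cancel h
  rw [← hinj.tsum_eq]
  · refine tsum_congr fun m => ?_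
    have h := congrArg (Nat.cast : ℕ → ENNReal) (sfa_aux_shift m j)
    push_cast at h
    have h5 : ∏ i, x i ^ ((m + Pi.single j 1 : ι → ℕ) i) = x j * ∏ i, x i ^ m i := by
      simp only [Pi.add_apply, pow_add, Finset.prod_mul_distrib]
      rw [mul_comm]
      congr 1
      rw [Fintype.prod_eq_single j]
      · simp
      · intro i hi; simp [hi]
    rw [h5]
    simp only [Pi.add_apply, Pi.single_eq_same]
    push_cast
    rw [← mul_assoc, h]
    ring
  · intro m hm
    refine ⟨m - Pi.single j 1, ?_⟩
    have hj : m j ≠ 0 := by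
      intro h0; simp [h0] at hm
    funext i
    by_cases hi : i = j
    · subst hi; simp; omega
    · simp [hi]

theorem sfa_aux_real0 {ι : Type*} [Fintype ι] (x : ι → ℝ) (hx : ∀ i, 0 ≤ x i)
    (hs : ∑ i, x i < 1) :
    ∑' m : ι → ℕ, ENNReal.ofReal (Nat.multinomial Finset.univ m * ∏ i, x i ^ m i) =
      ENNReal.ofReal (1 / (1 - ∑ i, x i)) := by
  have hs0 : 0 ≤ ∑ i, x i := Finset.sum_nonneg fun i _ => hx i
  have h := sfa_aux_multi (fun i => ENNReal.ofReal (x i)) (fun _ => 1)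
  simp only [one_mul] at h
  rw [one_div, ← tsum_geometric_of_lt_one hs0 hs, ENNReal.ofReal_tsum_of_nonneg
    (fun n => pow_nonneg hs0 n) (summable_geometric_of_lt_one hs0 hs)]
  convert h using 3 with m N
  · rw [ENNReal.ofReal_mul (by positivity), ENNReal.ofReal_natCast,
      ENNReal.ofReal_prod_of_nonneg (fun i _ => pow_nonneg (hx i) _)]
    simp_rw [ENNReal.ofReal_pow (hx _)]
  · rw [ENNReal.ofReal_pow hs0, ENNReal.ofReal_sum_of_nonneg fun i _ => hx i]

theorem sfa_aux_real1 {ι : Type*} [Fintype ι] (x : ι → ℝ) (hx : ∀ i, 0 ≤ x i)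
    (hs : ∑ i, x i < 1) (j : ι) :
    ∑' m : ι → ℕ, ENNReal.ofReal (m j * (Nat.multinomial Finset.univ m * ∏ i, x i ^ m i)) =
      ENNReal.ofReal (x j * (1 / (1 - ∑ i, x i)) ^ 2) := by
  have hs0 : 0 ≤ ∑ i, x i := Finset.sum_nonneg fun i _ => hx i
  have h := sfa_aux_moment (fun i => ENNReal.ofReal (x i)) j
  have hS : HasSum (fun N : ℕ => ((N : ℝ) + 1) * (∑ i, x i) ^ N) ((1 / (1 - ∑ i, x i)) ^ 2) := by
    have hn : ‖∑ i, x i‖ < 1 := by rwa [Real.norm_of_nonneg hs0]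
    have h1 := (hasSum_coe_mul_geometric_of_norm_lt_one hn).add (hasSum_geometric_of_lt_one hs0 hs)
    have hne : 1 - ∑ i, x i ≠ 0 := by linarith
    have e1 : (fun N : ℕ => ((N : ℝ) + 1) * (∑ i, x i) ^ N) =
        fun N : ℕ => (N : ℝ) * (∑ i, x i) ^ N + (∑ i, x i) ^ N := by
      funext N; ring
    have e2 : (1 / (1 - ∑ i, x i)) ^ 2 =
        (∑ i, x i) / (1 - ∑ i, x i) ^ 2 + (1 - ∑ i, x i)⁻¹ := by
      field_simp; ring
    rw [e1, e2]
    exact h1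
  rw [ENNReal.ofReal_mul (hx j), ← hS.tsum_eq, ENNReal.ofReal_tsum_of_nonneg
    (fun n => by positivity) hS.summable]
  convert h using 4 with m N
  · have hp : 0 ≤ ∏ i, x i ^ m i := Finset.prod_nonneg fun i _ => pow_nonneg (hx i) _
    rw [ENNReal.ofReal_mul (by positivity), ENNReal.ofReal_mul (by positivity),
      ENNReal.ofReal_natCast, ENNReal.ofReal_natCast,
      ENNReal.ofReal_prod_of_nonneg (fun i _ => pow_nonneg (hx i) _)]
    simp_rw [ENNReal.ofReal_pow (hx _)]
  · rw [ENNReal.ofReal_mul (by positivity), ENNReal.ofReal_pow hs0,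
      ENNReal.ofReal_sum_of_nonneg fun i _ => hx i, ENNReal.ofReal_add (by positivity) (by simp)]
    simp

/-- Regroup configurations by resource. -/
def sfaAuxEquiv {L J : Type*} (B : L → J → ℝ) :
    (sfaK B → ℕ) ≃ (∀ l : L, {j : J // 0 < B l j} → ℕ) where
  toFun m l j := m ⟨(l, j.1), j.2⟩
  invFun m p := m p.1.1 ⟨p.1.2, p.2⟩
  left_inv _ := rfl
  right_inv _ := rfl

/-- The weight of one resource. -/
def sfaAuxV {L J : Type*} [Fintype J]
    (B : L → J → ℝ) (C : L → ℝ) (α : J → ℝ) (l : L) (m : {j : J // 0 < B l j} → ℕ) : ℝ :=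
  Nat.multinomial Finset.univ m * ∏ i, (B l i.1 * α i.1 / C l) ^ m i

theorem sfa_aux_prodK' {L J : Type*} [Fintype L] [Fintype J] (B : L → J → ℝ)
    (f : sfaK B → ℝ) :
    ∏ p : sfaK B, f p = ∏ l : L, ∏ i : {j : J // 0 < B l j}, f ⟨(l, i.1), i.2⟩ := by
  let e : sfaK B ≃ (Σ l : L, {j : J // 0 < B l j}) :=
    { toFun := fun p => ⟨p.1.1, ⟨p.1.2, p.2⟩⟩
      invFun := fun q => ⟨(q.1, q.2.1), q.2.2⟩
      left_inv := fun _ => rfl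
      right_inv := fun _ => rfl }
  rw [← Fintype.prod_sigma' (fun l (i : {j : J // 0 < B l j}) => f ⟨(l, i.1), i.2⟩)]
  exact Fintype.prod_equiv e _ _ fun _ => rfl

theorem sfa_aux_prodCols {L J : Type*} [Fintype L] [Fintype J] (B : L → J → ℝ)
    (f : sfaK B → ℝ) :
    ∏ p : sfaK B, f p = ∏ i : J, ∏ l : {l : L // 0 < B l i}, f ⟨(l.1, i), l.2⟩ := by
  let e : sfaK B ≃ (Σ i : J, {l : L // 0 < B l i}) :=
    { toFun := fun p => ⟨p.1.2, ⟨p.1.1, p.2⟩⟩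
      invFun := fun q => ⟨(q.2.1, q.1), q.2.2⟩
      left_inv := fun _ => rfl
      right_inv := fun _ => rfl }
  rw [← Fintype.prod_sigma' (fun i (l : {l : L // 0 < B l i}) => f ⟨(l.1, i), l.2⟩)]
  exact Fintype.prod_equiv e _ _ fun _ => rfl

theorem sfa_aux_W {L J : Type*} [Fintype L] [Fintype J]
    (B : L → J → ℝ) (C : L → ℝ) (α : J → ℝ) (m : sfaK B → ℕ) :
    sfaW B C α m = ∏ l, sfaAuxV B C α l (sfaAuxEquiv B m l) := by
  unfold sfaW sfaAuxV
  rw [Finset.prod_mul_distrib, sfa_aux_prodK']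
  congr 1
  refine Finset.prod_congr rfl fun l _ => ?_
  have h := Nat.multinomial_spec Finset.univ (sfaAuxEquiv B m l)
  have h' := congrArg (Nat.cast : ℕ → ℝ) h
  push_cast at h'
  have hne : ∏ j : {j : J // 0 < B l j}, ((sfaAuxEquiv B m l j).factorial : ℝ) ≠ 0 :=
    Finset.prod_ne_zero_iff.2 fun j _ => by exact_mod_cast Nat.factorial_ne_zero _
  change (((∑ j, sfaAuxEquiv B m l j).factorial : ℕ) : ℝ) /
    ∏ j : {j : J // 0 < B l j}, ((sfaAuxEquiv B m l j).factorial : ℝ) = _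
  rw [← h', mul_div_assoc, mul_comm, div_mul_cancel₀ _ hne]

theorem sfa_aux_finite {L J : Type*} [Fintype L] [Fintype J] (B : L → J → ℝ) (n : J → ℕ) :
    Finite (sfaU B n) := by
  have hf : (Set.Icc (0 : sfaK B → ℕ) (fun p : sfaK B => n p.1.2)).Finite := by
    classical
    exact Set.finite_Icc _ _
  refine (hf.subset (t := {m : sfaK B → ℕ |
    ∀ j : J, (∑ l : {l : L // 0 < B l j}, m ⟨(l.1, j), l.2⟩) = n j}) ?_).to_subtype
  intro m hm
  refine ⟨fun p => Nat.zero_le _, fun p => ?_⟩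
  dsimp only
  rw [← hm p.1.2]
  exact Finset.single_le_sum
    (f := fun l : {l : L // 0 < B l p.1.2} => m ⟨(l.1, p.1.2), l.2⟩)
    (fun _ _ => Nat.zero_le _) (Finset.mem_univ (⟨p.1.1, p.2⟩ : {l : L // 0 < B l p.1.2}))

theorem sfa_aux_PhiFun {L J : Type*} [Fintype L] [Fintype J]
    (B : L → J → ℝ) (C : L → ℝ) (α : J → ℝ) (n : J → ℕ) :
    sfaPhiFun B C n * ∏ i, α i ^ n i = ∑' m : sfaU B n, sfaW B C α m.1 := by
  unfold sfaPhiFun sfaW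
  rw [← tsum_mul_right]
  refine tsum_congr fun m => ?_
  rw [mul_assoc]
  congr 1
  have h : ∏ i, α i ^ n i = ∏ p : sfaK B, α p.1.2 ^ m.1 p := by
    rw [sfa_aux_prodCols]
    refine Finset.prod_congr rfl fun i _ => ?_
    rw [← m.2 i]
    exact (Finset.prod_pow_eq_pow_sum _ _ _).symm
  rw [h, ← Finset.prod_mul_distrib]
  refine Finset.prod_congr rfl fun p _ => ?_
  rw [← mul_pow]
  congr 1
  ring

theorem sfa_aux_g {L J : Type*} [Fintype J]
    (B : L → J → ℝ) (C : L → ℝ) (α : J → ℝ) (hB : ∀ l j, 0 ≤ B l j) (l : L) :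
    ∑ i : {j : J // 0 < B l j}, B l i.1 * α i.1 / C l = (∑ i, B l i * α i) / C l := by
  rw [Finset.sum_div]
  rw [← Finset.sum_subtype (Finset.univ.filter fun j => 0 < B l j) (by simp)
    (fun i => B l i * α i / C l)]
  refine Finset.sum_subset (Finset.subset_univ _) fun i _ hi => ?_
  have h0 : B l i = 0 := le_antisymm (by simpa using hi) (hB l i)
  simp [h0]

theorem sfa_aux_main {L J : Type*} [Fintype L] [Fintype J]
    (B : L → J → ℝ) (C : L → ℝ) (α : J → ℝ)
    (hB : ∀ l j, 0 ≤ B l j) (hC : ∀ l, 0 < C l) (hα : ∀ j, 0 ≤ α j)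
    (hg : ∀ l, (∑ i : J, B l i * α i) / C l < 1)
    (j : J) (l : L) (hl : 0 < B l j) :
    ∑' m : sfaK B → ℕ, ENNReal.ofReal ((m ⟨(l, j), hl⟩ : ℝ) * sfaW B C α m) =
      ENNReal.ofReal ((B l j * α j / C l) * (1 / (1 - (∑ i : J, B l i * α i) / C l)) *
        sfaPhi B C α) := by
  classical
  have hx : ∀ l' (i : {j : J // 0 < B l' j}), 0 ≤ B l' i.1 * α i.1 / C l' := fun l' i =>
    div_nonneg (mul_nonneg (hB _ _) (hα _)) (hC _).le
  have hs : ∀ l', ∑ i : {j : J // 0 < B l' j}, B l' i.1 * α i.1 / C l' < 1 := fun l' => by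
    rw [sfa_aux_g B C α hB]; exact hg l'
  have hV : ∀ l' m, 0 ≤ sfaAuxV B C α l' m := fun l' m =>
    mul_nonneg (Nat.cast_nonneg _) (Finset.prod_nonneg fun i _ => pow_nonneg (hx l' i) _)
  let c : ∀ l', ({j : J // 0 < B l' j} → ℕ) → ℝ := fun l' m =>
    if l' = l then (if h : 0 < B l' j then (m ⟨j, h⟩ : ℝ) else 0) else 1
  have hc : ∀ l' m, 0 ≤ c l' m := by
    intro l' m; simp only [c]; split_ifs <;> positivity
  have h1 : ∀ m : sfaK B → ℕ, ENNReal.ofReal ((m ⟨(l, j), hl⟩ : ℝ) * sfaW B C α m) =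
      ∏ l', ENNReal.ofReal (c l' (sfaAuxEquiv B m l') *
        sfaAuxV B C α l' (sfaAuxEquiv B m l')) := by
    intro m
    rw [← ENNReal.ofReal_prod_of_nonneg (fun l' _ => mul_nonneg (hc _ _) (hV _ _)),
      Finset.prod_mul_distrib, ← sfa_aux_W]
    congr 2
    rw [Fintype.prod_eq_single l]
    · simp [c, hl, sfaAuxEquiv]
    · intro l' hl'; simp [c, hl']
  simp_rw [h1]
  rw [(sfaAuxEquiv B).tsum_eq (fun m => ∏ l', ENNReal.ofReal (c l' (m l') *
        sfaAuxV B C α l' (m l'))),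
    sfa_aux_tsum_pi (fun l' m => ENNReal.ofReal (c l' m * sfaAuxV B C α l' m))]
  have h2 : ∀ l', ∑' m, ENNReal.ofReal (c l' m * sfaAuxV B C α l' m) =
      ENNReal.ofReal ((if l' = l then
        (B l j * α j / C l) * (1 / (1 - (∑ i : J, B l i * α i) / C l)) else 1) *
        (C l' / (C l' - ∑ i, B l' i * α i))) := by
    intro l'
    have hk : C l' / (C l' - ∑ i, B l' i * α i) = 1 / (1 - (∑ i : J, B l' i * α i) / C l') := by
      have := (hC l').ne'
      rw [one_sub_div this, one_div_div]
    rw [hk]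
    by_cases h : l' = l
    · subst h
      have := sfa_aux_real1 _ (hx l') (hs l') ⟨j, hl⟩
      rw [sfa_aux_g B C α hB] at this
      simp only [c, hl, if_true, dif_pos]
      rw [mul_assoc, ← sq, ← this]
      rfl
    · have := sfa_aux_real0 _ (hx l') (hs l')
      rw [sfa_aux_g B C α hB] at this
      simp only [c, h, if_false, one_mul]
      rw [← this]
      rfl
  simp_rw [h2]
  have hpos : ∀ l', 0 < 1 - (∑ i : J, B l' i * α i) / C l' := fun l' => sub_pos.2 (hg l')
  have hpos' : ∀ l', 0 ≤ C l' / (C l' - ∑ i, B l' i * α i) := fun l' => by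
    have := hg l'
    rw [div_lt_one (hC l')] at this
    exact div_nonneg (hC l').le (by linarith)
  rw [← ENNReal.ofReal_prod_of_nonneg, Finset.prod_mul_distrib, Fintype.prod_eq_single l]
  · simp [sfaPhi]
  · intro l' hl'; simp [hl']
  · intro l' _
    refine mul_nonneg ?_ (hpos' l')
    split_ifs
    · exact mul_nonneg (hx l ⟨j, hl⟩) (one_div_nonneg.2 (hpos l).le)
    · exact zero_le_one

/-- Proposition 4.3: under the stability condition `g_l < 1` for all `l`,
the expected number of flows on route `j` under the SFA stationary distribution
`π(n) = Φ(n) ∏_i α_i^{n_i} / Φ` equals `Σ_{l : (l,j) ∈ K} (B_{lj} α_j / C_l)/(1 - g_l)`. -/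
theorem sfa_expected_flows_on_route
    {L J : Type*} [Fintype L] [Fintype J] [Nonempty L] [Nonempty J]
    (B : L → J → ℝ) (C : L → ℝ) (α : J → ℝ)
    (hB : ∀ l j, 0 ≤ B l j) (hC : ∀ l, 0 < C l) (hα : ∀ j, 0 ≤ α j)
    (hg : ∀ l, (∑ i : J, B l i * α i) / C l < 1)
    (j : J) :
    Summable (fun n : J → ℕ =>
        (n j : ℝ) * (sfaPhiFun B C n * (∏ i : J, α i ^ n i) / sfaPhi B C α)) ∧
      (∑' n : J → ℕ,
          (n j : ℝ) * (sfaPhiFun B C n * (∏ i : J, α i ^ n i) / sfaPhi B C α)) =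
        ∑ l : {l : L // 0 < B l j},
          (B l.1 j * α j / C l.1) * (1 / (1 - (∑ i : J, B l.1 i * α i) / C l.1)) := by
  classical
  have hx : ∀ l' i, 0 ≤ B l' i * α i / C l' := fun l' i =>
    div_nonneg (mul_nonneg (hB _ _) (hα _)) (hC _).le
  have hW : ∀ m, 0 ≤ sfaW B C α m := fun m => by
    rw [sfa_aux_W]
    exact Finset.prod_nonneg fun l _ => mul_nonneg (Nat.cast_nonneg _)
      (Finset.prod_nonneg fun i _ => pow_nonneg (hx l i) _)
  have hPhi : 0 < sfaPhi B C α := Finset.prod_pos fun l _ => by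
    have := hg l
    rw [div_lt_one (hC l)] at this
    exact div_pos (hC l) (by linarith)
  have hpos : ∀ l', 0 < 1 - (∑ i : J, B l' i * α i) / C l' := fun l' => sub_pos.2 (hg l')
  set R := ∑ l : {l : L // 0 < B l j},
          (B l.1 j * α j / C l.1) * (1 / (1 - (∑ i : J, B l.1 i * α i) / C l.1)) with hR
  have hR0 : 0 ≤ R := Finset.sum_nonneg fun l _ =>
    mul_nonneg (hx _ _) (one_div_nonneg.2 (hpos _).le)
  let F : (J → ℕ) → ℝ := fun n =>
    (n j : ℝ) * (sfaPhiFun B C n * (∏ i : J, α i ^ n i) / sfaPhi B C α)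
  let G : (sfaK B → ℕ) → ℝ := fun m =>
    (∑ l : {l : L // 0 < B l j}, (m ⟨(l.1, j), l.2⟩ : ℝ) * sfaW B C α m) / sfaPhi B C α
  have hG : ∀ m, 0 ≤ G m := fun m => div_nonneg
    (Finset.sum_nonneg fun l _ => mul_nonneg (Nat.cast_nonneg _) (hW m)) hPhi.le
  have hFG : ∀ n, F n = ∑' m : sfaU B n, G m.1 := by
    intro n
    simp only [F, G]
    rw [sfa_aux_PhiFun, mul_div_assoc', ← tsum_mul_left, ← tsum_div_const]
    refine tsum_congr fun m => ?_
    rw [← Finset.sum_mul, ← m.2 j]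
    push_cast
    rfl
  have hF : ∀ n, 0 ≤ F n := fun n => by
    rw [hFG]; exact tsum_nonneg fun m => hG _
  have hFE : ∀ n, ENNReal.ofReal (F n) = ∑' m : sfaU B n, ENNReal.ofReal (G m.1) := by
    intro n
    have := sfa_aux_finite B n
    rw [hFG, ENNReal.ofReal_tsum_of_nonneg (fun m => hG _) (Summable.of_finite ..)]
  have hsum : ∑' n, ENNReal.ofReal (F n) = ENNReal.ofReal R := by
    simp_rw [hFE]
    let q : (sfaK B → ℕ) → (J → ℕ) := fun m j =>
      ∑ l : {l : L // 0 < B l j}, m ⟨(l.1, j), l.2⟩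
    have e1 : ∀ n, ∑' m : sfaU B n, ENNReal.ofReal (G m.1) =
        ∑' m : q ⁻¹' {n}, ENNReal.ofReal (G m.1) := by
      intro n
      refine (Equiv.subtypeEquivRight (fun m => ?_)).tsum_eq
        (fun m : q ⁻¹' {n} => ENNReal.ofReal (G m.1))
      simp [q, funext_iff]
    simp_rw [e1]
    rw [ENNReal.tsum_fiberwise (fun m => ENNReal.ofReal (G m)) q]
    have e2 : ∀ m, ENNReal.ofReal (G m) = (∑ l : {l : L // 0 < B l j},
        ENNReal.ofReal ((m ⟨(l.1, j), l.2⟩ : ℝ) * sfaW B C α m)) *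
          ENNReal.ofReal (sfaPhi B C α)⁻¹ := by
      intro m
      simp only [G]
      rw [div_eq_mul_inv, ENNReal.ofReal_mul' (inv_nonneg.2 hPhi.le),
        ENNReal.ofReal_sum_of_nonneg fun l _ => mul_nonneg (Nat.cast_nonneg _) (hW m)]
    simp_rw [e2]
    rw [ENNReal.tsum_mul_right, Summable.tsum_finsetSum (fun _ _ => ENNReal.summable)]
    rw [Finset.sum_congr rfl fun (l : {l : L // 0 < B l j}) _ =>
      sfa_aux_main B C α hB hC hα hg j l.1 l.2]
    rw [← ENNReal.ofReal_sum_of_nonneg, ← ENNReal.ofReal_mul' (inv_nonneg.2 hPhi.le),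
      ← Finset.sum_mul, mul_assoc, mul_inv_cancel₀ hPhi.ne', mul_one]
    intro l _
    exact mul_nonneg (mul_nonneg (hx _ _) (one_div_nonneg.2 (hpos _).le)) hPhi.le
  have hne : ∑' n, ENNReal.ofReal (F n) ≠ ⊤ := by rw [hsum]; exact ENNReal.ofReal_ne_top
  have hS := ENNReal.hasSum_toReal hne
  rw [← ENNReal.tsum_toReal_eq (fun n => ENNReal.ofReal_ne_top), hsum,
    ENNReal.toReal_ofReal hR0] at hS
  have hS' : HasSum F R := by
    have e : (fun n => (ENNReal.ofReal (F n)).toReal) = F :=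
      funext fun n => ENNReal.toReal_ofReal (hF n)
    rw [e] at hS
    exact hS
  exact ⟨hS'.summable, hS'.tsum_eq⟩
end
end

section
/- Per-flow waiting delay bound under SFA congestion control (Theorem 4.1, reduction to stationary expectations): in the setting of the virtual bandwidth-sharing network with unit capacities, let t ∈ T be a type with λ_t > 0, let d_t = |r(t)| be the number of nodes on its route, and let ρ_t < 1 be any real with f_v ≤ ρ_t for all v ∈ r(t). Then the stationary mean delay of type t satisfies (1/λ_t) · Σ_{n : T → ℕ} n_t · π(n) = Σ_{v ∈ r(t)} x_t/(1 − f_v) ≤ x_t d_t / (1 − ρ_t). -/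
open scoped BigOperators

noncomputable section

universe u v

open scoped ENNReal in
lemma aux_tsum_pi_prod {ι : Type u} [Fintype ι] (β : ι → Type v) (h : ∀ i, β i → ℝ≥0∞) :
      ∑' m : (∀ i, β i), ∏ i, h i (m i) = ∏ i, ∑' k, h i k := by
  revert β
  refine Fintype.induction_empty_option (P := fun (ι : Type u) [Fintype ι] =>
    ∀ (β : ι → Type v) (h : ∀ i, β i → ℝ≥0∞),
      ∑' m : (∀ i, β i), ∏ i, h i (m i) = ∏ i, ∑' k, h i k) ?_ ?_ ?_ ι
  · intro α γ _ e ih β h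
    let _ : Fintype α := Fintype.ofEquiv γ e.symm
    have := ih (fun i => β (e i)) (fun i => h (e i))
    rw [← Equiv.prod_comp e, ← this, ← (Equiv.piCongrLeft β e).tsum_eq]
    refine tsum_congr fun m => ?_
    rw [← Equiv.prod_comp e]
    simp [Equiv.piCongrLeft_apply_apply]
  · intro β h; simp
  · intro α _ ih β h
    rw [← (Equiv.piOptionEquivProd (β := β)).symm.tsum_eq, ENNReal.tsum_prod', Fintype.prod_option,
      ← ih, ← ENNReal.tsum_mul_right]
    refine tsum_congr fun m => ?_
    rw [← ENNReal.tsum_mul_left]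
    refine tsum_congr fun m' => ?_
    rw [Fintype.prod_option]
    rfl

open scoped ENNReal in
lemma aux_geom_sq (x : ℝ≥0∞) : ∑' N : ℕ, ((N : ℝ≥0∞) + 1) * x ^ N = (1 - x)⁻¹ ^ 2 := by
  rw [sq, ← ENNReal.tsum_geometric, ← ENNReal.tsum_mul_right]
  simp_rw [← ENNReal.tsum_mul_left]
  rw [← ENNReal.tsum_prod (f := fun i j : ℕ => x ^ i * x ^ j),
    ← (Finset.HasAntidiagonal.sigmaAntidiagonalEquivProd (A := ℕ)).tsum_eq, ENNReal.tsum_sigma']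
  refine tsum_congr fun N => ?_
  rw [tsum_fintype]
  have : ∀ b ∈ (Finset.univ : Finset (Finset.HasAntidiagonal.antidiagonal N)),
      x ^ ((Finset.HasAntidiagonal.sigmaAntidiagonalEquivProd ⟨N, b⟩).1) *
        x ^ ((Finset.HasAntidiagonal.sigmaAntidiagonalEquivProd ⟨N, b⟩).2) = x ^ N := by
    rintro ⟨⟨i, j⟩, hb⟩ -
    simp only [Finset.HasAntidiagonal.mem_antidiagonal] at hb
    simp [← pow_add, hb]
  rw [Finset.sum_congr rfl this]
  simp

open scoped ENNReal in
lemma aux_group {ι : Type*} [Fintype ι] (a : ι → ℝ≥0∞) (c : ℕ → ℝ≥0∞) :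
    ∑' k : ι → ℕ, c (∑ i, k i) * ((Nat.multinomial Finset.univ k : ℝ≥0∞) * ∏ i, a i ^ k i) =
      ∑' N, c N * (∑ i, a i) ^ N := by
  classical
  have h1 : ∀ k : ι → ℕ,
      c (∑ i, k i) * ((Nat.multinomial Finset.univ k : ℝ≥0∞) * ∏ i, a i ^ k i) =
      ∑' N, if ∑ i, k i = N then
        c N * ((Nat.multinomial Finset.univ k : ℝ≥0∞) * ∏ i, a i ^ k i) else 0 := by
    intro k
    rw [tsum_eq_single (∑ i, k i)]
    · simp
    · intro N hN; simp [hN.symm]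
  simp_rw [h1]
  rw [ENNReal.tsum_comm]
  refine tsum_congr fun N => ?_
  rw [Finset.sum_pow_eq_sum_piAntidiag, Finset.mul_sum,
    tsum_eq_sum (s := Finset.piAntidiag Finset.univ N)]
  · refine Finset.sum_congr rfl fun k hk => ?_
    rw [if_pos (by simpa using hk)]
  · intro k hk
    rw [if_neg (by simpa using hk)]

lemma aux_multinomial_shift {ι : Type*} [Fintype ι] [DecidableEq ι] (t : ι) (k : ι → ℕ) :
    (k t + 1) * Nat.multinomial Finset.univ (k + Pi.single t 1) =
      (∑ i, k i + 1) * Nat.multinomial Finset.univ k := by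
  have h1 := Nat.multinomial_spec Finset.univ (k + Pi.single t 1)
  have h2 := Nat.multinomial_spec Finset.univ k
  have h3 : ∑ i, (k + Pi.single t 1 : ι → ℕ) i = ∑ i, k i + 1 := by
    simp [Finset.sum_add_distrib]
  have h4 : ∏ i, ((k + Pi.single t 1 : ι → ℕ) i).factorial = (k t + 1) * ∏ i, (k i).factorial := by
    have : ∀ i, ((k + Pi.single t 1 : ι → ℕ) i).factorial =
        (if i = t then k t + 1 else 1) * (k i).factorial := by
      intro i
      by_cases hi : i = t
      · subst hi; simp [Nat.factorial_succ]
      · simp [hi]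
    simp_rw [this]
    rw [Finset.prod_mul_distrib]
    simp
  rw [h3, h4, Nat.factorial_succ, ← h2] at h1
  have hpos : 0 < ∏ i, (k i).factorial := Finset.prod_pos fun i _ => Nat.factorial_pos _
  apply Nat.eq_of_mul_eq_mul_left hpos
  linarith

open scoped ENNReal in
lemma aux_node_zero {ι : Type*} [Fintype ι] (a : ι → ℝ≥0∞) :
    ∑' k : ι → ℕ, ((Nat.multinomial Finset.univ k : ℝ≥0∞) * ∏ i, a i ^ k i) =
      (1 - ∑ i, a i)⁻¹ := by
  have := aux_group a (fun _ => 1)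
  simpa [ENNReal.tsum_geometric] using this

open scoped ENNReal in
lemma aux_node_one {ι : Type*} [Fintype ι] (a : ι → ℝ≥0∞) (t : ι) :
    ∑' k : ι → ℕ, (k t : ℝ≥0∞) *
      ((Nat.multinomial Finset.univ k : ℝ≥0∞) * ∏ i, a i ^ k i) =
      a t * (1 - ∑ i, a i)⁻¹ ^ 2 := by
  classical
  have hinj : Function.Injective (fun k : ι → ℕ => k + Pi.single t 1) :=
    fun k k' h => add_right_cancel h
  rw [← aux_geom_sq, ← aux_group a (fun N => (N : ℝ≥0∞) + 1), ← ENNReal.tsum_mul_left,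
    ← hinj.tsum_eq]
  · refine tsum_congr fun k => ?_
    have h1 : (((k t + 1) * Nat.multinomial Finset.univ (k + Pi.single t 1) : ℕ) : ℝ≥0∞) =
      (((∑ i, k i + 1) * Nat.multinomial Finset.univ k : ℕ) : ℝ≥0∞) := by
      rw [aux_multinomial_shift]
    have h2 : ∏ i, a i ^ (k + Pi.single t 1 : ι → ℕ) i = a t * ∏ i, a i ^ k i := by
      have : ∀ i, a i ^ (k + Pi.single t 1 : ι → ℕ) i =
          (if i = t then a t else 1) * a i ^ k i := by
        intro i
        by_cases hi : i = t
        · subst hi; simp [pow_succ, mul_comm]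
        · simp [hi]
      simp_rw [this]
      rw [Finset.prod_mul_distrib]
      simp
    rw [h2]
    push_cast at h1
    simp only [Pi.add_apply, Pi.single_eq_same, Nat.cast_add, Nat.cast_one, Nat.cast_sum] at h1 ⊢
    rw [← mul_assoc, h1]
    ring
  · intro k hk
    have hk0 : k t ≠ 0 := by
      intro h0; simp [h0] at hk
    refine ⟨k - Pi.single t 1, ?_⟩
    funext i
    by_cases hi : i = t
    · subst hi; simp; omega
    · simp [hi]

/-- Configurations on pairs as families of per-node configurations. -/
def auxEquiv {L J : Type*} (B : L → J → ℝ) :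
    (sfaK B → ℕ) ≃ (∀ l : L, {j : J // 0 < B l j} → ℕ) where
  toFun m l j := m ⟨(l, j.1), j.2⟩
  invFun q p := q p.1.1 ⟨p.1.2, p.2⟩
  left_inv _ := rfl
  right_inv _ := rfl

open scoped ENNReal in
/-- ENNReal weight of a configuration. -/
def auxE {L J : Type*} [Fintype L] [Fintype J] (B : L → J → ℝ) (a : J → ℝ≥0∞)
    (m : sfaK B → ℕ) : ℝ≥0∞ :=
  ∏ l : L, ((Nat.multinomial Finset.univ
      (fun j : {j : J // 0 < B l j} => m ⟨(l, j.1), j.2⟩) : ℝ≥0∞) *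
    ∏ j : {j : J // 0 < B l j}, a j.1 ^ m ⟨(l, j.1), j.2⟩)

open scoped ENNReal in
lemma aux_moment {L J : Type*} [Fintype L] [Fintype J] (B : L → J → ℝ) (a : J → ℝ≥0∞)
    (l : L) (t : J) (ht : 0 < B l t) :
    ∑' m : sfaK B → ℕ, (m ⟨(l, t), ht⟩ : ℝ≥0∞) * auxE B a m =
      a t * (1 - ∑ j : {j : J // 0 < B l j}, a j.1)⁻¹ *
        ∏ u : L, (1 - ∑ j : {j : J // 0 < B u j}, a j.1)⁻¹ := by
  classical
  let c : ∀ u : L, ({j : J // 0 < B u j} → ℕ) → ℝ≥0∞ := fun u k =>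
    if u = l then (if h : 0 < B u t then (k ⟨t, h⟩ : ℝ≥0∞) else 0) else 1
  have h1 := aux_tsum_pi_prod (fun u : L => ({j : J // 0 < B u j} → ℕ))
    (fun u k => c u k * ((Nat.multinomial Finset.univ k : ℝ≥0∞) * ∏ j, a j.1 ^ k j))
  rw [← (auxEquiv B).tsum_eq] at h1
  have h2 : ∀ m : sfaK B → ℕ, (m ⟨(l, t), ht⟩ : ℝ≥0∞) * auxE B a m =
      ∏ u, (c u (auxEquiv B m u) * ((Nat.multinomial Finset.univ (auxEquiv B m u) : ℝ≥0∞) *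
        ∏ j, a j.1 ^ auxEquiv B m u j)) := by
    intro m
    rw [Finset.prod_mul_distrib]
    congr 1
    rw [Finset.prod_eq_single l]
    · simp [c, ht, auxEquiv]
    · intro u _ hu; simp [c, hu]
    · simp
  simp_rw [h2]
  rw [h1]
  have h3 : ∀ u : L, ∑' k, c u k * ((Nat.multinomial Finset.univ k : ℝ≥0∞) * ∏ j, a j.1 ^ k j) =
      (if u = l then a t * (1 - ∑ j : {j : J // 0 < B l j}, a j.1)⁻¹ else 1) *
        (1 - ∑ j : {j : J // 0 < B u j}, a j.1)⁻¹ := by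
    intro u
    by_cases hu : u = l
    · subst hu
      simp only [c, if_true, ht, dite_true]
      rw [aux_node_one (fun j : {j : J // 0 < B u j} => a j.1) ⟨t, ht⟩]
      ring
    · simp only [c, hu, if_false, one_mul]
      exact aux_node_zero (fun j : {j : J // 0 < B u j} => a j.1)
  simp_rw [h3]
  rw [Finset.prod_mul_distrib]
  simp

open scoped ENNReal in
lemma aux_total {L J : Type*} [Fintype L] [Fintype J] (B : L → J → ℝ) (a : J → ℝ≥0∞) (t : J) :
    ∑' n : J → ℕ, (n t : ℝ≥0∞) * ∑' m : sfaU B n, auxE B a m.1 =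
      (∑ l : {l : L // 0 < B l t},
        a t * (1 - ∑ j : {j : J // 0 < B l.1 j}, a j.1)⁻¹) *
        ∏ u : L, (1 - ∑ j : {j : J // 0 < B u j}, a j.1)⁻¹ := by
  classical
  have h1 : ∀ n : J → ℕ, (n t : ℝ≥0∞) * ∑' m : sfaU B n, auxE B a m.1 =
      ∑' m : sfaK B → ℕ,
        if (fun j => ∑ l : {l : L // 0 < B l j}, m ⟨(l.1, j), l.2⟩) = n then
          (n t : ℝ≥0∞) * auxE B a m else 0 := by
    intro n
    rw [← ENNReal.tsum_mul_left]
    have := tsum_subtype {m : sfaK B → ℕ |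
      ∀ j : J, (∑ l : {l : L // 0 < B l j}, m ⟨(l.1, j), l.2⟩) = n j}
      (fun m => (n t : ℝ≥0∞) * auxE B a m)
    refine this.trans (tsum_congr fun m => ?_)
    simp only [Set.indicator, Set.mem_ofPred_eq, funext_iff]
  simp_rw [h1]
  rw [ENNReal.tsum_comm, Finset.sum_mul]
  rw [Finset.sum_congr rfl (fun l _ => (aux_moment B a l.1 t l.2).symm)]
  rw [← Summable.tsum_finsetSum (fun _ _ => ENNReal.summable)]
  refine tsum_congr fun m => ?_
  rw [tsum_eq_single (fun j => ∑ l : {l : L // 0 < B l j}, m ⟨(l.1, j), l.2⟩)]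
  · simp [Finset.sum_mul]
  · intro n hn; simp [hn.symm]

lemma aux_weight {L J : Type*} [Fintype L] [Fintype J] (B : L → J → ℝ)
    (hB : ∀ l j, 0 < B l j → B l j = 1) (α : J → ℝ) (hα : ∀ j, 0 ≤ α j) (n : J → ℕ)
    (m : sfaU B n) :
    ((∏ l : L,
        ((Nat.factorial (∑ j : {j : J // 0 < B l j}, m.1 ⟨(l, j.1), j.2⟩) : ℝ) /
          ∏ j : {j : J // 0 < B l j}, (Nat.factorial (m.1 ⟨(l, j.1), j.2⟩) : ℝ))) *
      ∏ p : sfaK B, (B p.1.1 p.1.2 / 1) ^ m.1 p) * ∏ j, α j ^ n j =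
    (auxE B (fun j => ENNReal.ofReal (α j)) m.1).toReal := by
  have h1 : ∏ p : sfaK B, (B p.1.1 p.1.2 / 1) ^ m.1 p = 1 := by
    refine Finset.prod_eq_one fun p _ => ?_
    rw [hB _ _ p.2]; simp
  have h2 : ∏ j, α j ^ n j =
      ∏ l : L, ∏ j : {j : J // 0 < B l j}, α j.1 ^ m.1 ⟨(l, j.1), j.2⟩ := by
    have : ∀ j, α j ^ n j = ∏ l : {l : L // 0 < B l j}, α j ^ m.1 ⟨(l.1, j), l.2⟩ := by
      intro j
      rw [Finset.prod_pow_eq_pow_sum, m.2 j]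
    simp_rw [this]
    rw [← Fintype.prod_sigma' (fun (j : J) (l : {l : L // 0 < B l j}) =>
        α j ^ m.1 ⟨(l.1, j), l.2⟩),
      ← Fintype.prod_sigma' (fun (l : L) (j : {j : J // 0 < B l j}) =>
        α j.1 ^ m.1 ⟨(l, j.1), j.2⟩)]
    refine Fintype.prod_equiv
      { toFun := fun p => ⟨p.2.1, ⟨p.1, p.2.2⟩⟩
        invFun := fun p => ⟨p.2.1, ⟨p.1, p.2.2⟩⟩
        left_inv := fun _ => rfl
        right_inv := fun _ => rfl } _ _ (fun _ => rfl)
  rw [h1, mul_one, h2, ← Finset.prod_mul_distrib, auxE, ENNReal.toReal_prod]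
  refine Finset.prod_congr rfl fun l _ => ?_
  rw [ENNReal.toReal_mul, ENNReal.toReal_prod]
  congr 1
  · rw [ENNReal.toReal_natCast, ← Nat.multinomial_spec]
    push_cast
    rw [mul_comm, mul_div_assoc, div_self, mul_one]
    exact Finset.prod_ne_zero_iff.2 fun i _ => by positivity
  · refine Finset.prod_congr rfl fun j _ => ?_
    rw [ENNReal.toReal_pow, ENNReal.toReal_ofReal (hα _)]

lemma aux_E_ne_top {L J : Type*} [Fintype L] [Fintype J] (B : L → J → ℝ) (α : J → ℝ)
    (m : sfaK B → ℕ) : auxE B (fun j => ENNReal.ofReal (α j)) m ≠ ⊤ := by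
  unfold auxE
  refine ENNReal.prod_ne_top fun l _ => ENNReal.mul_ne_top (ENNReal.natCast_ne_top _) ?_
  exact ENNReal.prod_ne_top fun j _ => ENNReal.pow_ne_top ENNReal.ofReal_ne_top

lemma aux_phi {L J : Type*} [Fintype L] [Fintype J] (B : L → J → ℝ)
    (hB : ∀ l j, 0 < B l j → B l j = 1) (α : J → ℝ) (hα : ∀ j, 0 ≤ α j) (n : J → ℕ) :
    sfaPhiFun B (fun _ => 1) n * ∏ j, α j ^ n j =
      (∑' m : sfaU B n, auxE B (fun j => ENNReal.ofReal (α j)) m.1).toReal := by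
  have h1 : (∑' m : sfaU B n, auxE B (fun j => ENNReal.ofReal (α j)) m.1).toReal =
      ∑' m : sfaU B n, (auxE B (fun j => ENNReal.ofReal (α j)) m.1).toReal :=
    ENNReal.tsum_toReal_eq (fun m => aux_E_ne_top B α m.1)
  have h2 := tsum_congr (L := SummationFilter.unconditional _) fun m : sfaU B n => aux_weight B hB α hα n m
  rw [tsum_mul_right] at h2
  rw [h1, ← h2]
  rfl

lemma aux_real {L J : Type*} [Fintype L] [Fintype J] (B : L → J → ℝ)
    (hB : ∀ l j, 0 < B l j → B l j = 1) (α : J → ℝ) (hα : ∀ j, 0 ≤ α j)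
    (hf : ∀ l, ∑ j : {j : J // 0 < B l j}, α j.1 < 1) (t : J) :
    ∑' n : J → ℕ, (n t : ℝ) * (sfaPhiFun B (fun _ => 1) n * ∏ j, α j ^ n j) =
      (∑ l : {l : L // 0 < B l t}, α t * (1 - ∑ j : {j : J // 0 < B l.1 j}, α j.1)⁻¹) *
        ∏ u : L, (1 - ∑ j : {j : J // 0 < B u j}, α j.1)⁻¹ := by
  have key := aux_total B (fun j => ENNReal.ofReal (α j)) t
  have hg : ∀ l : L, (1 - ∑ j : {j : J // 0 < B l j}, ENNReal.ofReal (α j.1))⁻¹ =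
      ENNReal.ofReal (1 - ∑ j : {j : J // 0 < B l j}, α j.1)⁻¹ := by
    intro l
    rw [← ENNReal.ofReal_sum_of_nonneg (fun j _ => hα j.1), ← ENNReal.ofReal_one,
      ← ENNReal.ofReal_sub _ (Finset.sum_nonneg fun j _ => hα j.1),
      ENNReal.ofReal_inv_of_pos (sub_pos.2 (hf l))]
  have hg0 : ∀ l : L, 0 ≤ (1 - ∑ j : {j : J // 0 < B l j}, α j.1)⁻¹ :=
    fun l => inv_nonneg.2 (sub_pos.2 (hf l)).le
  simp_rw [hg, ← ENNReal.ofReal_mul (hα t)] at key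
  rw [← ENNReal.ofReal_sum_of_nonneg (fun l _ => mul_nonneg (hα t) (hg0 l.1)),
    ← ENNReal.ofReal_prod_of_nonneg (fun l _ => hg0 l),
    ← ENNReal.ofReal_mul (Finset.sum_nonneg fun l _ => mul_nonneg (hα t) (hg0 l.1))] at key
  have hfin := ENNReal.ne_top_of_tsum_ne_top (key.trans_ne ENNReal.ofReal_ne_top)
  have := congrArg ENNReal.toReal key
  rw [ENNReal.tsum_toReal_eq hfin, ENNReal.toReal_ofReal (mul_nonneg
    (Finset.sum_nonneg fun l _ => mul_nonneg (hα t) (hg0 l.1))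
    (Finset.prod_nonneg fun l _ => hg0 l))] at this
  rw [← this]
  refine tsum_congr fun n => ?_
  rw [ENNReal.toReal_mul, ENNReal.toReal_natCast, aux_phi B hB α hα n]

/-- Theorem 4.1, reduction to stationary expectations: in the virtual
bandwidth-sharing network with unit capacities, for a type `t` with `λ_t > 0`, route
`r(t)` with `d_t = |r(t)|` nodes, and any `ρ_t < 1` with `f_v ≤ ρ_t` for all `v ∈ r(t)`,
the stationary mean delay of type `t` satisfies
`(1/λ_t) · Σ_n n_t π(n) = Σ_{v ∈ r(t)} x_t/(1 - f_v) ≤ x_t d_t / (1 - ρ_t)`. -/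
theorem sfa_waiting_delay_bound
    {V T : Type*} [Fintype V] [Fintype T] [DecidableEq V] [Nonempty V] [Nonempty T]
    (r : T → Finset V) (hr : ∀ t, (r t).Nonempty)
    (x lam : T → ℝ) (hx : ∀ t, 0 < x t) (hlam : ∀ t, 0 ≤ lam t)
    (hf : ∀ v : V, (∑ t : T, if v ∈ r t then x t * lam t else 0) < 1)
    (t : T) (hlamt : 0 < lam t)
    (ρ : ℝ) (hρ : ρ < 1)
    (hfρ : ∀ v ∈ r t, (∑ t' : T, if v ∈ r t' then x t' * lam t' else 0) ≤ ρ) :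
    (1 / lam t) *
        (∑' n : T → ℕ,
          (n t : ℝ) *
            (sfaPhiFun (fun v t' => if v ∈ r t' then (1 : ℝ) else 0) (fun _ => 1) n *
                (∏ t' : T, (x t' * lam t') ^ n t') /
              sfaPhi (fun v t' => if v ∈ r t' then (1 : ℝ) else 0) (fun _ => 1)
                (fun t' => x t' * lam t'))) =
      (∑ v ∈ r t, x t / (1 - ∑ t' : T, if v ∈ r t' then x t' * lam t' else 0)) ∧
    (∑ v ∈ r t, x t / (1 - ∑ t' : T, if v ∈ r t' then x t' * lam t' else 0)) ≤
      x t * (r t).card / (1 - ρ) := by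
  have hB : ∀ (v : V) (t' : T), 0 < (if v ∈ r t' then (1 : ℝ) else 0) →
      (if v ∈ r t' then (1 : ℝ) else 0) = 1 := by
    intro v t' h
    by_cases hv : v ∈ r t'
    · simp [hv]
    · simp [hv] at h
  have hα : ∀ t', 0 ≤ x t' * lam t' := fun t' => mul_nonneg (hx t').le (hlam t')
  have hsum : ∀ v : V, ∑ j : {j : T // 0 < (if v ∈ r j then (1 : ℝ) else 0)}, x j.1 * lam j.1 =
      ∑ t' : T, if v ∈ r t' then x t' * lam t' else 0 := by
    intro v
    rw [← Finset.sum_filter]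
    symm
    refine Finset.sum_subtype _ (fun t' => ?_) (fun t' => x t' * lam t')
    by_cases hv : v ∈ r t' <;> simp [hv]
  have key := aux_real (fun v t' => if v ∈ r t' then (1 : ℝ) else 0) hB
    (fun t' => x t' * lam t') hα (fun v => by rw [hsum]; exact hf v) t
  have hpos : ∀ v : V, 0 < 1 - ∑ t' : T, if v ∈ r t' then x t' * lam t' else 0 :=
    fun v => sub_pos.2 (hf v)
  refine ⟨?_, ?_⟩
  · simp_rw [← mul_div_assoc]
    rw [tsum_div_const, key]
    simp_rw [hsum]
    have hP : sfaPhi (fun v t' => if v ∈ r t' then (1 : ℝ) else 0) (fun _ => 1)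
        (fun t' => x t' * lam t') =
        ∏ v : V, (1 - ∑ t' : T, if v ∈ r t' then x t' * lam t' else 0)⁻¹ := by
      simp [sfaPhi]
    have hP0 : ∏ v : V, (1 - ∑ t' : T, if v ∈ r t' then x t' * lam t' else 0)⁻¹ ≠ 0 :=
      Finset.prod_ne_zero_iff.2 fun v _ => inv_ne_zero (hpos v).ne'
    rw [hP, mul_div_cancel_right₀ _ hP0, Finset.mul_sum]
    have hs : (∑ v ∈ r t, x t / (1 - ∑ t' : T, if v ∈ r t' then x t' * lam t' else 0)) =
        ∑ v : {v : V // 0 < (if v ∈ r t then (1 : ℝ) else 0)},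
          x t / (1 - ∑ t' : T, if v.1 ∈ r t' then x t' * lam t' else 0) :=
      Finset.sum_subtype (r t)
        (fun v => by by_cases hv : v ∈ r t <;> simp [hv])
        (fun v => x t / (1 - ∑ t' : T, if v ∈ r t' then x t' * lam t' else 0))
    rw [hs]
    refine Finset.sum_congr rfl fun v _ => ?_
    have := (hpos v.1).ne'
    field_simp
  · have : ∀ v ∈ r t, x t / (1 - ∑ t' : T, if v ∈ r t' then x t' * lam t' else 0) ≤
        x t / (1 - ρ) := by
      intro v hv
      have h1 := hfρ v hv
      exact div_le_div_of_nonneg_left (hx t).le (by linarith) (by linarith)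
    refine (Finset.sum_le_card_nsmul _ _ _ this).trans (le_of_eq ?_)
    rw [nsmul_eq_mul]
    ring
end
end
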